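/- arXiv:2604.09365 — 5 statements merged into one kernel-verified Lean document; each statement's English description precedes it below -/
import Mathlib

section
/- Let (u_k)_{k≥0} be a sequence of real numbers satisfying u_0 ≤ 1 and u_{k+1} ≤ u_k + √(1 + u_k²) for every k ≥ 0. Then for every k ≥ 0 one has u_k ≤ cot(π / 2^{k+2}). -/
open Real

theorem monotone_add_sqrt_one_add_sq : Monotone fun x : ℝ => x + √(1 + x ^ 2) := by
  intro x y hxy
  have hy : -y ≤ √(1 + y ^ 2) := Real.le_sqrt_of_sq_le (by nlinarith)
  have hs : √(1 + y ^ 2) ^ 2 = 1 + y ^ 2 := Real.sq_sqrt (by positivity)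
  have h : √(1 + x ^ 2) ≤ (y - x) + √(1 + y ^ 2) := by
    refine Real.sqrt_le_iff.2 ⟨add_nonneg (sub_nonneg.2 hxy) (Real.sqrt_nonneg _), ?_⟩
    nlinarith [mul_nonneg (sub_nonneg.2 hxy) (neg_le_iff_add_nonneg.1 hy)]
  change x + √(1 + x ^ 2) ≤ y + √(1 + y ^ 2)
  linarith

theorem cot_half_eq_cot_add_sqrt {α : ℝ} (hα : 0 < α) (hαπ : α < π) :
    Real.cot (α / 2) = Real.cot α + √(1 + Real.cot α ^ 2) := by
  have hsin : 0 < sin α := sin_pos_of_pos_of_lt_pi hα hαπ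
  have hsin_half : 0 < sin (α / 2) := sin_pos_of_pos_of_lt_pi (by linarith) (by linarith)
  have hcos_half : 0 < cos (α / 2) := cos_pos_of_mem_Ioo ⟨by linarith, by linarith⟩
  have hsq : 1 + Real.cot α ^ 2 = (1 / sin α) ^ 2 := by
    rw [Real.cot_eq_cos_div_sin]
    field_simp
    exact sin_sq_add_cos_sq α
  have hs : sin α = 2 * sin (α / 2) * cos (α / 2) := by
    rw [← sin_two_mul, mul_div_cancel₀ α two_ne_zero]
  have hc : cos α = 2 * cos (α / 2) ^ 2 - 1 := by
    rw [← cos_two_mul, mul_div_cancel₀ α two_ne_zero]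
  rw [hsq, Real.sqrt_sq (by positivity), Real.cot_eq_cos_div_sin, Real.cot_eq_cos_div_sin, hs, hc]
  field_simp
  ring

theorem cotlar_induction (u : ℕ → ℝ) (h0 : u 0 ≤ 1)
    (hrec : ∀ k : ℕ, u (k + 1) ≤ u k + Real.sqrt (1 + (u k) ^ 2)) :
    ∀ k : ℕ, u k ≤ Real.cot (π / 2 ^ (k + 2)) := by
  intro k
  induction k with
  | zero =>
    have h : Real.cot (π / 2 ^ (0 + 2)) = 1 := by
      rw [← inv_inj, Real.cot_inv_eq_tan, inv_one, ← Real.tan_pi_div_four]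
      norm_num
    rwa [h]
  | succ k ih =>
    have hlt : π / 2 ^ (k + 2) < π :=
      div_lt_self pi_pos (one_lt_pow₀ one_lt_two (by positivity))
    calc u (k + 1) ≤ u k + √(1 + u k ^ 2) := hrec k
      _ ≤ _ := monotone_add_sqrt_one_add_sq ih
      _ = Real.cot (π / 2 ^ (k + 2) / 2) := (cot_half_eq_cot_add_sqrt (by positivity) hlt).symm
      _ = Real.cot (π / 2 ^ (k + 1 + 2)) := by
        rw [div_div, ← pow_succ, Nat.add_right_comm k 1 2]
end

section
/- Let γ_d denote the standard Gaussian measure on ℝ^d, dγ_d = (2π)^{−d/2} e^{−|y|²/2} dy. Then for every ξ ∈ ℝ^d with ξ ≠ 0 and every j ∈ {1, …, d}, ∫_{ℝ^d} sgn(ξ·y) · y_j dγ_d(y) = √(2/π) · ξ_j / |ξ|. -/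
open Real MeasureTheory

open ProbabilityTheory
open scoped NNReal ENNReal RealInnerProductSpace

theorem integral_abs_gaussianReal {v : ℝ≥0} (hv : v ≠ 0) :
    ∫ x, |x| ∂gaussianReal 0 v = √(2 / π) * √v := by
  have hv' : (0 : ℝ) < v := by positivity
  have hI := integral_rpow_mul_exp_neg_mul_rpow (p := 2) (q := 1) (b := (2 * (v : ℝ))⁻¹)
    (by norm_num) (by norm_num) (by positivity)
  norm_num [rpow_neg_one, one_div] at hI
  rw [integral_gaussianReal_eq_integral_smul hv]
  calc ∫ x, gaussianPDFReal 0 v x • |x|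
      = ∫ x, (√(2 * π * v))⁻¹ * (|x| * rexp (-((v : ℝ)⁻¹ * (1 / 2) * |x| ^ 2))) := by
        congr with x
        simp only [gaussianPDFReal, sub_zero, smul_eq_mul, sq_abs]
        rw [show -x ^ 2 / (2 * (v : ℝ)) = -((v : ℝ)⁻¹ * (1 / 2) * x ^ 2) by field_simp]
        ring
    _ = (√(2 * π * v))⁻¹ * (2 * v) := by
        rw [integral_const_mul,
          integral_comp_abs (f := fun x ↦ x * rexp (-((v : ℝ)⁻¹ * (1 / 2) * x ^ 2))), hI]
        ring
    _ = √(2 / π) * √v := by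
        rw [← sqrt_mul (by positivity), inv_mul_eq_div, div_eq_iff (by positivity),
          ← sqrt_mul (by positivity), eq_comm, sqrt_eq_iff_mul_self_eq (by positivity)
          (by positivity)]
        field_simp

theorem Measure.pi_gaussianReal_eq_withDensity {ι : Type*} [Fintype ι] :
    Measure.pi (fun _ : ι ↦ gaussianReal 0 1) =
      (volume : Measure (ι → ℝ)).withDensity
        fun y ↦ ENNReal.ofReal (∏ i, gaussianPDFReal 0 1 (y i)) := by
  refine Measure.pi_eq fun s hs ↦ ?_
  have hint (i : ι) : Integrable ((s i).indicator (gaussianPDFReal 0 1)) :=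
    (integrable_gaussianPDFReal 0 1).indicator (hs i)
  have hnn (i : ι) (x : ℝ) : 0 ≤ (s i).indicator (gaussianPDFReal 0 1) x :=
    Set.indicator_nonneg (fun x _ ↦ gaussianPDFReal_nonneg 0 1 x) x
  have hprod : (Set.univ.pi s).indicator
      (fun y ↦ ENNReal.ofReal (∏ i, gaussianPDFReal 0 1 (y i))) =
      fun y ↦ ENNReal.ofReal (∏ i, (s i).indicator (gaussianPDFReal 0 1) (y i)) := by
    ext y
    by_cases hy : y ∈ Set.univ.pi s
    · rw [Set.indicator_of_mem hy]
      congr! 2 with i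
      rw [Set.indicator_of_mem (hy i (Set.mem_univ i))]
    · obtain ⟨i, hi⟩ : ∃ i, y i ∉ s i := by simpa using hy
      rw [Set.indicator_of_notMem hy, Finset.prod_eq_zero (Finset.mem_univ i)
        (Set.indicator_of_notMem hi _), ENNReal.ofReal_zero]
  have hbox : MeasurableSet (Set.univ.pi s) := .univ_pi hs
  rw [withDensity_apply _ hbox, ← lintegral_indicator hbox, hprod,
    ← ofReal_integral_eq_lintegral_ofReal (μ := volume) (Integrable.fintype_prod_dep hint)
      (ae_of_all _ fun y ↦ Finset.prod_nonneg fun i _ ↦ hnn i _),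
    integral_fintype_prod_volume_eq_prod (fun i ↦ (s i).indicator (gaussianPDFReal 0 1)),
    ENNReal.ofReal_prod_of_nonneg fun i _ ↦ integral_nonneg (hnn i)]
  congr with i
  rw [gaussianReal_apply_eq_integral 0 one_ne_zero, integral_indicator (hs i)]

theorem prod_gaussianPDFReal_zero_one {ι : Type*} [Fintype ι] (y : ι → ℝ) :
    ∏ i, gaussianPDFReal 0 1 (y i) =
      (2 * π) ^ (-(Fintype.card ι : ℝ) / 2) * rexp (-(∑ i, y i ^ 2) / 2) := by
  simp only [gaussianPDFReal, sub_zero, NNReal.coe_one, mul_one, Finset.prod_mul_distrib,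
    Finset.prod_const, Finset.card_univ, ← exp_sum, ← Finset.sum_div, Finset.sum_neg_distrib]
  rw [sqrt_eq_rpow, ← rpow_neg (by positivity), ← rpow_natCast, ← rpow_mul (by positivity)]
  congr 2
  ring

theorem integral_pi_gaussianReal {ι : Type*} [Fintype ι] (f : (ι → ℝ) → ℝ) :
    ∫ y, f y ∂Measure.pi (fun _ : ι ↦ gaussianReal 0 1) =
      ∫ y, f y * ((2 * π) ^ (-(Fintype.card ι : ℝ) / 2) * rexp (-(∑ i, y i ^ 2) / 2)) := by
  rw [Measure.pi_gaussianReal_eq_withDensity, integral_withDensity_eq_integral_toReal_smul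
    (by fun_prop) (by simp)]
  congr with y
  rw [ENNReal.toReal_ofReal (Finset.prod_nonneg fun i _ ↦ gaussianPDFReal_nonneg 0 1 _),
    prod_gaussianPDFReal_zero_one, smul_eq_mul, mul_comm]

@[fun_prop]
theorem Real.measurable_sign : Measurable Real.sign :=
  Measurable.ite measurableSet_Iio measurable_const
    (Measurable.ite measurableSet_Ioi measurable_const measurable_const)

section stdGaussian

variable {E : Type*} [NormedAddCommGroup E] [InnerProductSpace ℝ E] [FiniteDimensional ℝ E]
  [MeasurableSpace E] [BorelSpace E]

theorem integral_abs_inner_stdGaussian {u : E} (hu : u ≠ 0) :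
    ∫ x, |⟪u, x⟫| ∂stdGaussian E = √(2 / π) * ‖u‖ := by
  have hmap : (stdGaussian E).map (innerSL ℝ u) = gaussianReal 0 (‖u‖ ^ 2).toNNReal := by
    rw [IsGaussian.map_eq_gaussianReal, integral_strongDual_stdGaussian,
      variance_dual_stdGaussian, innerSL_apply_norm]
  have hv : (‖u‖ ^ 2).toNNReal ≠ 0 := by simpa using hu
  have h := integral_abs_gaussianReal hv
  rw [← hmap, integral_map (by fun_prop) (by fun_prop), coe_toNNReal _ (by positivity),
    sqrt_sq (norm_nonneg u)] at h
  simpa using h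

/-- The projection of `x ↦ sign ⟪u, x⟫` onto the first Wiener chaos, tested against `⟪a, ·⟫`. -/
theorem integral_sign_inner_mul_inner_stdGaussian {u : E} (hu : u ≠ 0) (a : E) :
    ∫ x, Real.sign ⟪u, x⟫ * ⟪a, x⟫ ∂stdGaussian E = √(2 / π) * ⟪a, u⟫ / ‖u‖ := by
  have hu' : ‖u‖ ≠ 0 := norm_ne_zero_iff.2 hu
  have hinner (b : E) : Integrable (fun x ↦ ⟪b, x⟫) (stdGaussian E) :=
    (innerSL ℝ b).integrable_comp IsGaussian.integrable_id
  have hsign : Integrable (fun x ↦ Real.sign ⟪u, x⟫ * ⟪a, x⟫) (stdGaussian E) := by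
    refine (hinner a).bdd_mul (c := 1)
      (Measurable.aestronglyMeasurable (by fun_prop)) (ae_of_all _ fun x ↦ ?_)
    obtain h | h | h := Real.sign_apply_eq ⟪u, x⟫ <;> simp [h]
  let s := (ℝ ∙ u).reflection
  have hs (x : E) : s x = (2 * (⟪u, x⟫ / ‖u‖ ^ 2)) • u - x := by
    simp [s, Submodule.reflection_apply, Submodule.starProjection_singleton, two_smul,
      two_mul, add_smul]
  have hreflect (x : E) : Real.sign ⟪u, s x⟫ * ⟪a, s x⟫ =
      2 * (⟪a, u⟫ / ‖u‖ ^ 2) * |⟪u, x⟫| - Real.sign ⟪u, x⟫ * ⟪a, x⟫ := by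
    have hus : ⟪u, s x⟫ = ⟪u, x⟫ := by
      rw [hs, inner_sub_right, real_inner_smul_right, real_inner_self_eq_norm_sq]
      field_simp
      ring
    have habs : Real.sign ⟪u, x⟫ * ⟪u, x⟫ = |⟪u, x⟫| := by
      obtain h | h | h := lt_trichotomy ⟪u, x⟫ 0
      · rw [Real.sign_of_neg h, abs_of_neg h, neg_one_mul]
      · simp [h]
      · rw [Real.sign_of_pos h, abs_of_pos h, one_mul]
    rw [hus, hs, inner_sub_right, real_inner_smul_right, ← habs]
    ring
  have h : ∫ x, Real.sign ⟪u, x⟫ * ⟪a, x⟫ ∂stdGaussian E =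
      2 * (⟪a, u⟫ / ‖u‖ ^ 2) * (√(2 / π) * ‖u‖) -
        ∫ x, Real.sign ⟪u, x⟫ * ⟪a, x⟫ ∂stdGaussian E := by
    conv_lhs => rw [← stdGaussian_map s]
    rw [integral_map s.continuous.aemeasurable
      (Measurable.aestronglyMeasurable (by fun_prop))]
    refine (integral_congr_ae (ae_of_all _ hreflect)).trans ?_
    rw [integral_sub ((hinner u).abs.const_mul _) hsign, integral_const_mul,
      integral_abs_inner_stdGaussian hu]
  have h' : 2 * (⟪a, u⟫ / ‖u‖ ^ 2) * (√(2 / π) * ‖u‖) = 2 * (√(2 / π) * ⟪a, u⟫ / ‖u‖) := by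
    field_simp
  linarith

end stdGaussian

theorem gaussian_projection_sign_first_chaos (d : ℕ) (hd : 1 ≤ d)
    (ξ : Fin d → ℝ) (hξ : ξ ≠ 0) (j : Fin d) :
    (∫ y : Fin d → ℝ,
        Real.sign (∑ i, ξ i * y i) * y j *
          ((2 * π) ^ (-(d : ℝ) / 2) * Real.exp (-(∑ i, (y i) ^ 2) / 2))) =
      Real.sqrt (2 / π) * ξ j / Real.sqrt (∑ i, (ξ i) ^ 2) := by
  have hξ' : WithLp.toLp 2 ξ ≠ 0 := by simpa using hξ
  have h := integral_sign_inner_mul_inner_stdGaussian hξ' (EuclideanSpace.single j 1)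
  rw [← map_pi_eq_stdGaussian,
    integral_map (by fun_prop) (Measurable.aestronglyMeasurable (by fun_prop)),
    integral_pi_gaussianReal] at h
  simpa [EuclideanSpace.norm_eq, PiLp.inner_apply, mul_comm] using h
end

section
/- For every real q ≥ 2, one has ( 2^{q/2} Γ((q+1)/2) / √π )^{1/q} ≤ √(q − 1); equivalently 2^{q/2} Γ((q+1)/2) ≤ √π · (q − 1)^{q/2}. -/
open Real

/-- A Stirling-type upper bound on one period, from log-convexity between `3/2` and `5/2`. -/
lemma log_Gamma_add_one_le {t : ℝ} (h₁ : 1 / 2 ≤ t) (h₂ : t ≤ 3 / 2) :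
    log (Gamma (t + 1)) ≤ log √π + (t + 1 / 2) * log t := by
  have ht : 0 < t := by linarith
  have hπ : (0 : ℝ) < √π := by positivity
  have hGamma : Gamma (3 / 2) = √π / 2 := by
    rw [show (3 / 2 : ℝ) = 1 / 2 + 1 by norm_num, Gamma_add_one (by norm_num), Gamma_one_half_eq]
    ring
  have hGamma' : Gamma (5 / 2) = 3 / 2 * (√π / 2) := by
    rw [show (5 / 2 : ℝ) = 3 / 2 + 1 by norm_num, Gamma_add_one (by norm_num), hGamma]
  have hconv := convexOn_log_Gamma.2 (x := 3 / 2) (y := 5 / 2)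
    (by norm_num [Set.mem_Ioi]) (by norm_num [Set.mem_Ioi])
    (show 0 ≤ 3 / 2 - t by linarith) (show 0 ≤ t - 1 / 2 by linarith) (by ring)
  simp only [smul_eq_mul, Function.comp_apply] at hconv
  rw [show (3 / 2 - t) * (3 / 2) + (t - 1 / 2) * (5 / 2) = t + 1 by ring, hGamma, hGamma',
    log_mul (by norm_num) (by positivity), log_div hπ.ne' (by norm_num)] at hconv
  have hlog : 1 - 1 / (2 * t) ≤ log 2 + log t := by
    have := one_sub_inv_le_log_of_pos (show 0 < 2 * t by positivity)
    rwa [log_mul (by norm_num) ht.ne', ← one_div] at this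
  have hlog₂ : log 2 + log (3 / 2) ≤ 4 / 3 := by
    linarith [log_two_lt_d9, log_le_sub_one_of_pos (show (0 : ℝ) < 3 / 2 by norm_num)]
  have hinv : 4 / 3 ≤ (t + 1 / 2) / t := by
    rw [le_div_iff₀ ht]
    linarith
  have hmul : (t - 1 / 2) * (log 2 + log (3 / 2)) ≤ (t + 1 / 2) * (log 2 + log t) :=
    calc (t - 1 / 2) * (log 2 + log (3 / 2))
        ≤ (t - 1 / 2) * ((t + 1 / 2) / t) :=
          mul_le_mul_of_nonneg_left (hlog₂.trans hinv) (by linarith)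
      _ = (t + 1 / 2) * (1 - 1 / (2 * t)) := by field_simp
      _ ≤ _ := mul_le_mul_of_nonneg_left hlog (by linarith)
  linarith

lemma Gamma_add_one_le_sqrt_pi_mul_rpow {t : ℝ} (ht : 1 / 2 ≤ t) :
    Gamma (t + 1) ≤ √π * t ^ (t + 1 / 2) := by
  obtain ⟨n, hn⟩ := exists_nat_ge (t - 3 / 2)
  induction n generalizing t with
  | zero =>
    have hpos : 0 < t := by linarith
    rw [← log_le_log_iff (Gamma_pos_of_pos (by linarith)) (by positivity),
      log_mul (by positivity) (by positivity), log_rpow hpos]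
    exact log_Gamma_add_one_le ht (by simpa using hn)
  | succ n ih =>
    rcases le_total t (3 / 2) with h | h
    · exact ih ht (by linarith [n.cast_nonneg (α := ℝ)])
    have hpos : 0 < t := by linarith
    have hprev := ih (t := t - 1) (by linarith) (by push_cast at hn; linarith)
    rw [show t - 1 + 1 = t by ring, show t - 1 + 1 / 2 = t - 1 / 2 by ring] at hprev
    calc Gamma (t + 1) = t * Gamma t := Gamma_add_one hpos.ne'
      _ ≤ t * (√π * t ^ (t - 1 / 2)) := by
        gcongr
        refine hprev.trans ?_
        gcongr <;> linarith
      _ = √π * t ^ (t + 1 / 2) := by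
        rw [show t + 1 / 2 = t - 1 / 2 + 1 by ring, rpow_add_one hpos.ne']
        ring

theorem gaussian_moment_hypercontractive_bound (q : ℝ) (hq : 2 ≤ q) :
    (2 ^ (q / 2) * Real.Gamma ((q + 1) / 2) / Real.sqrt π) ^ (1 / q) ≤
        Real.sqrt (q - 1) ∧
      2 ^ (q / 2) * Real.Gamma ((q + 1) / 2) ≤ Real.sqrt π * (q - 1) ^ (q / 2) := by
  have hq₁ : 0 ≤ q - 1 := by linarith
  have hmoment : 2 ^ (q / 2) * Gamma ((q + 1) / 2) ≤ √π * (q - 1) ^ (q / 2) := by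
    have h := Gamma_add_one_le_sqrt_pi_mul_rpow (t := (q - 1) / 2) (by linarith)
    rw [show (q - 1) / 2 + 1 = (q + 1) / 2 by ring,
      show (q - 1) / 2 + 1 / 2 = q / 2 by ring] at h
    calc 2 ^ (q / 2) * Gamma ((q + 1) / 2)
        ≤ 2 ^ (q / 2) * (√π * ((q - 1) / 2) ^ (q / 2)) := by gcongr
      _ = √π * (q - 1) ^ (q / 2) := by
        rw [div_rpow hq₁ (by norm_num)]
        field_simp
  refine ⟨?_, hmoment⟩
  have hGamma : 0 < Gamma ((q + 1) / 2) := Gamma_pos_of_pos (by linarith)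
  calc (2 ^ (q / 2) * Gamma ((q + 1) / 2) / √π) ^ (1 / q)
      ≤ ((q - 1) ^ (q / 2)) ^ (1 / q) := by
        gcongr
        rw [div_le_iff₀ (by positivity), mul_comm _ √π]
        exact hmoment
    _ = √(q - 1) := by
        rw [← rpow_mul hq₁, sqrt_eq_rpow]
        congr 1
        field_simp
end

section
/- Define γ(r) = ( 2^{r/2} Γ((r+1)/2) / √π )^{1/r} for r > 0. Then the function r ↦ γ(r)/√r is nonincreasing on (1, ∞), and consequently for every p with 1 < p < 2 and conjugate exponent q = p/(p−1), one has γ(q)/γ(p) ≤ 1/√(p−1). -/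
open Real

/-- `γ(r) = (2^{r/2} Γ((r+1)/2)/√π)^{1/r}`, the `L^r`-norm of a standard normal
random variable. -/
noncomputable def gaussianNorm (r : ℝ) : ℝ :=
  (2 ^ (r / 2) * Real.Gamma ((r + 1) / 2) / Real.sqrt π) ^ (1 / r)

theorem concaveOn_mulLog_step_sub_log_midpoint :
    ConcaveOn ℝ (Set.Ici 0)
      (fun x : ℝ => (x + 1) * log (x + 1) - x * log x - log (x + 1 / 2)) := by
  refine concaveOn_of_hasDerivWithinAt2_nonpos (convex_Ici 0)
    (f' := fun x => log (x + 1) - log x - 1 / (x + 1 / 2))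
    (f'' := fun x => 1 / (x + 1) - 1 / x + 1 / (x + 1 / 2) ^ 2) ?_ ?_ ?_ ?_
  · refine ContinuousOn.sub (Continuous.continuousOn ?_) ?_
    · exact (continuous_mul_log.comp (continuous_id.add continuous_const)).sub continuous_mul_log
    · refine ContinuousOn.log (by fun_prop) fun x hx => ?_
      have : (0 : ℝ) ≤ x := hx
      positivity
  · intro x hx
    rw [interior_Ici] at hx
    have hx0 : (0 : ℝ) < x := hx
    have h1 : HasDerivAt (fun x : ℝ => x + 1) 1 x := (hasDerivAt_id x).add_const 1
    have h2 : HasDerivAt (fun x : ℝ => x + 1 / 2) 1 x := (hasDerivAt_id x).add_const _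
    have h := (((h1.mul (h1.log (by positivity))).sub (hasDerivAt_mul_log hx0.ne')).sub
      (h2.log (by positivity))).hasDerivWithinAt (s := interior (Set.Ici 0))
    refine h.congr_deriv ?_
    field_simp
    ring
  · intro x hx
    rw [interior_Ici] at hx
    have hx0 : (0 : ℝ) < x := hx
    have h1 : HasDerivAt (fun x : ℝ => x + 1) 1 x := (hasDerivAt_id x).add_const 1
    have h2 : HasDerivAt (fun x : ℝ => x + 1 / 2) 1 x := (hasDerivAt_id x).add_const _
    have h := (((h1.log (by positivity)).sub (hasDerivAt_log hx0.ne')).sub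
      ((hasDerivAt_const x (1 : ℝ)).div h2 (by positivity))).hasDerivWithinAt
        (s := interior (Set.Ici 0))
    refine h.congr_deriv ?_
    field_simp
    ring
  · intro x hx
    rw [interior_Ici] at hx
    have hx0 : (0 : ℝ) < x := hx
    have h : 1 / (x + 1 / 2) ^ 2 ≤ 1 / (x * (x + 1)) :=
      one_div_le_one_div_of_le (by positivity) (by nlinarith)
    have h' : 1 / (x + 1) - 1 / x = -(1 / (x * (x + 1))) := by
      field_simp
      ring
    rw [h']
    linarith

theorem concaveOn_logGammaSeq_sub_mul_log (n : ℕ) :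
    ConcaveOn ℝ (Set.Ici 0)
      (fun s : ℝ => BohrMollerup.logGammaSeq (s + 1 / 2) n - s * log s) := by
  have shift (f : ℝ → ℝ) (hf : ConcaveOn ℝ (Set.Ici 0) f) (m : ℕ) :
      ConcaveOn ℝ (Set.Ici 0) (fun s => f (s + m)) := by
    refine (hf.translate_left (m : ℝ)).subset (fun x hx => ?_) (convex_Ici 0)
    have : (0 : ℝ) ≤ x := hx
    simp only [Set.mem_preimage, Set.mem_Ici]
    positivity
  have telescope (N : ℕ) : ConcaveOn ℝ (Set.Ici 0) (fun s : ℝ =>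
      (s + N) * log (s + N) - s * log s - ∑ m ∈ Finset.range N, log (s + 1 / 2 + m)) := by
    induction N with
    | zero => simpa using concaveOn_const (𝕜 := ℝ) (0 : ℝ) (convex_Ici 0)
    | succ N ih =>
      refine (ih.add (shift _ concaveOn_mulLog_step_sub_log_midpoint N)).congr fun s _ => ?_
      simp only [Pi.add_apply, Finset.sum_range_succ, Nat.cast_add, Nat.cast_one]
      rw [show s + N + 1 / 2 = s + 1 / 2 + N by ring, show s + (N + 1) = s + N + 1 by ring]
      ring
  have affine : ConcaveOn ℝ (Set.Ici 0)
      (fun s : ℝ => (s + 1 / 2) * log n + log (n.factorial)) :=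
    ⟨convex_Ici 0, fun x _ y _ a b _ _ hab => le_of_eq (by
      simp only [smul_eq_mul]
      linear_combination (1 / 2 * log n + log (n.factorial)) * hab)⟩
  refine (((telescope (n + 1)).add (shift _ concaveOn_negMulLog (n + 1))).add affine).congr
    fun s _ => ?_
  simp only [Pi.add_apply, negMulLog, BohrMollerup.logGammaSeq]
  ring

/-- On `[0, ∞)` the function `log Γ(s + 1/2) - s log s` is concave; equivalently, the trigamma
function at `s + 1/2` is at most `1 / s`. -/
theorem concaveOn_log_Gamma_add_half_sub_mul_log :
    ConcaveOn ℝ (Set.Ici 0) (fun s : ℝ => log (Gamma (s + 1 / 2)) - s * log s) := by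
  have lim (s : ℝ) (hs : 0 ≤ s) : Filter.Tendsto
      (fun n => BohrMollerup.logGammaSeq (s + 1 / 2) n - s * log s) Filter.atTop
      (nhds (log (Gamma (s + 1 / 2)) - s * log s)) :=
    (BohrMollerup.tendsto_log_gamma (by positivity)).sub_const _
  refine ⟨convex_Ici 0, fun x hx y hy a b ha hb hab => ?_⟩
  exact le_of_tendsto_of_tendsto' (((lim x hx).const_smul a).add ((lim y hy).const_smul b))
    (lim _ (convex_Ici (0 : ℝ) hx hy ha hb hab))
    fun n => (concaveOn_logGammaSeq_sub_mul_log n).2 hx hy ha hb hab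

theorem gaussianNorm_pos {r : ℝ} (hr : 0 < r) : 0 < gaussianNorm r := by
  have := Gamma_pos_of_pos (show 0 < (r + 1) / 2 by positivity)
  unfold gaussianNorm
  positivity

theorem gaussianNorm_div_sqrt_eq_exp {r : ℝ} (hr : 0 < r) :
    gaussianNorm r / √r =
      exp ((log (Gamma (r / 2 + 1 / 2)) - r / 2 * log (r / 2) - log √π) / r) := by
  have hG : 0 < Gamma (r / 2 + 1 / 2) := Gamma_pos_of_pos (by positivity)
  have hp : 0 < √π := sqrt_pos.2 pi_pos
  rw [← exp_log (div_pos (gaussianNorm_pos hr) (sqrt_pos.2 hr)),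
    log_div (gaussianNorm_pos hr).ne' (sqrt_pos.2 hr).ne', gaussianNorm,
    show (r + 1) / 2 = r / 2 + 1 / 2 by ring, log_rpow (by positivity),
    log_div (by positivity) hp.ne', log_mul (by positivity) hG.ne', log_rpow two_pos,
    log_sqrt hr.le, log_div hr.ne' two_ne_zero]
  congr 1
  field_simp
  ring

theorem antitoneOn_gaussianNorm_div_sqrt :
    AntitoneOn (fun r => gaussianNorm r / √r) (Set.Ioi (0 : ℝ)) := by
  intro x hx y hy hxy
  have hx0 : 0 < x := hx
  have hy0 : 0 < y := hy
  have h := concaveOn_log_Gamma_add_half_sub_mul_log.2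
    (Set.self_mem_Ici (a := (0 : ℝ))) (show y / 2 ∈ Set.Ici (0 : ℝ) from by
      simp only [Set.mem_Ici]; positivity)
    (sub_nonneg.2 ((div_le_one hy0).2 hxy)) (div_pos hx0 hy0).le (sub_add_cancel _ _)
  have hxy2 : x / y * (y / 2) = x / 2 := by field_simp
  simp only [smul_eq_mul, mul_zero, zero_add, zero_mul, sub_zero, hxy2,
    Gamma_one_half_eq] at h
  simp only [gaussianNorm_div_sqrt_eq_exp hx0, gaussianNorm_div_sqrt_eq_exp hy0]
  rw [exp_le_exp, le_div_iff₀ hx0, div_mul_eq_mul_div, mul_comm, ← div_mul_eq_mul_div]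
  linarith

theorem gaussianNorm_div_sqrt_antitone_and_ratio :
    AntitoneOn (fun r => gaussianNorm r / Real.sqrt r) (Set.Ioi (1 : ℝ)) ∧
      ∀ p : ℝ, 1 < p → p < 2 →
        gaussianNorm (p / (p - 1)) / gaussianNorm p ≤ 1 / Real.sqrt (p - 1) := by
  refine ⟨antitoneOn_gaussianNorm_div_sqrt.mono (Set.Ioi_subset_Ioi zero_le_one), ?_⟩
  intro p hp1 hp2
  have hp0 : 0 < p := by linarith
  have hs : 0 < p - 1 := by linarith
  have hq : 0 < p / (p - 1) := by positivity
  have hpq : p ≤ p / (p - 1) := by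
    rw [le_div_iff₀ hs]
    nlinarith
  have h := antitoneOn_gaussianNorm_div_sqrt hp0 hq hpq
  simp only [sqrt_div hp0.le] at h
  have hsp := sqrt_pos.2 hp0
  have hss := sqrt_pos.2 hs
  rw [div_le_div_iff₀ (by positivity) hsp] at h
  rw [div_le_div_iff₀ (gaussianNorm_pos hp0) hss, one_mul]
  rw [mul_div_assoc', le_div_iff₀ hss] at h
  nlinarith
end

section
/- For p > 1 let q = p/(p−1) and define D(p) = Γ(1/p) Γ(1/q + 1/2) / ( Γ(1/q) Γ(1/p + 1/2) ). Then lim_{p→∞} D(p) / cot(π/(2p)) = π/4. -/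
open Real Filter

/-- The function `t ↦ tan (c t) / t` tends to `c` as `t → 0`, `t ≠ 0`. -/
lemma tendsto_tan_mul_div_self (c : ℝ) :
    Tendsto (fun t : ℝ => Real.tan (c * t) / t) (nhdsWithin 0 {0}ᶜ) (nhds c) := by
  have h : HasDerivAt (fun t : ℝ => Real.tan (c * t)) c 0 := by
    have h1 : HasDerivAt Real.tan 1 (c * 0) := by
      simpa using Real.hasDerivAt_tan (x := c * 0) (by simp)
    simpa [Function.comp_def] using h1.comp (0 : ℝ) ((hasDerivAt_id (0 : ℝ)).const_mul c)
  refine (hasDerivAt_iff_tendsto_slope.1 h).congr fun t => ?_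
  simp [slope_def_field]

theorem conjectured_norm_asymptotics (D : ℝ → ℝ)
    (hD : ∀ p : ℝ, 1 < p →
      D p = Real.Gamma (1 / p) * Real.Gamma ((p - 1) / p + 1 / 2) /
        (Real.Gamma ((p - 1) / p) * Real.Gamma (1 / p + 1 / 2))) :
    Tendsto (fun p : ℝ => D p / Real.cot (π / (2 * p))) atTop (nhds (π / 4)) := by
  have hcont : ∀ s : ℝ, 0 < s → ContinuousAt Real.Gamma s := fun s hs =>
    (Real.differentiableAt_Gamma fun m => by
      have : (0 : ℝ) ≤ m := m.cast_nonneg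
      linarith).continuousAt
  have hΓ : ∀ f : ℝ → ℝ, Continuous f → 0 < f 0 →
      Tendsto (fun t => Real.Gamma (f t)) (nhdsWithin 0 {0}ᶜ) (nhds (Real.Gamma (f 0))) :=
    fun f hf h0 => ((hcont _ h0).comp (f := f) hf.continuousAt).tendsto.mono_left
      nhdsWithin_le_nhds
  have h1 := hΓ (fun t => t + 1) (by fun_prop) (by norm_num)
  have h2 := hΓ (fun t => 1 - t + 1 / 2) (by fun_prop) (by norm_num)
  have h3 := hΓ (fun t => 1 - t) (by fun_prop) (by norm_num)
  have h4 := hΓ (fun t => t + 1 / 2) (by fun_prop) (by norm_num)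
  have hhalf : Real.Gamma (1 / 2) ≠ 0 := (Real.Gamma_pos_of_pos (by norm_num)).ne'
  have hthree : Real.Gamma (1 + 1 / 2) = 1 / 2 * Real.Gamma (1 / 2) := by
    rw [add_comm, Real.Gamma_add_one (by norm_num)]
  have hlim := ((h1.mul h2).div (h3.mul h4) (by simpa using hhalf)).mul
    (tendsto_tan_mul_div_self (π / 2))
  have hval : Real.Gamma (0 + 1) * Real.Gamma (1 - 0 + 1 / 2) /
      (Real.Gamma (1 - 0) * Real.Gamma (0 + 1 / 2)) * (π / 2) = π / 4 := by
    rw [sub_zero, zero_add, zero_add, hthree, Real.Gamma_one]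
    field_simp
    norm_num
  rw [hval] at hlim
  have hinv : Tendsto (fun p : ℝ => p⁻¹) atTop (nhdsWithin 0 {0}ᶜ) :=
    tendsto_inv_atTop_nhdsGT_zero.mono_right
      (nhdsWithin_mono _ fun x (hx : 0 < x) => hx.ne')
  refine (hlim.comp hinv).congr' ?_
  filter_upwards [eventually_gt_atTop 1] with p hp
  have hp0 : p ≠ 0 := by positivity
  have hq : (p - 1) / p = 1 - p⁻¹ := by field_simp
  have ha : π / (2 * p) = π / 2 * p⁻¹ := by field_simp
  simp only [Function.comp_apply, Pi.div_apply]
  rw [hD p hp, hq, ha, div_eq_mul_inv _ (Real.cot _), Real.cot_inv_eq_tan,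
    Real.Gamma_add_one (inv_ne_zero hp0), one_div p]
  field_simp
end
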